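/- arXiv:1812.03924 — 2 statements merged into one kernel-verified Lean document; each statement's English description precedes it below -/
import Mathlib

section
/- Let n ≥ 1 and let V : ℝⁿ → ℝ be a twice continuously differentiable function satisfying the static KID equation of hyperbolic space, ∂ᵢ∂ⱼV(x) − ∑ₖ Γ̄^k_{ij}(x) ∂ₖV(x) = V(x) ḡ_{ij}(x) for all x ∈ ℝⁿ and all i, j. Then the function x ↦ ∑_{i,j} ḡ^{ij}(x) ∂ᵢV(x) ∂ⱼV(x) − V(x)², i.e. |∇V|²_ḡ − V², is constant on ℝⁿ. -/
open Real MeasureTheory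

noncomputable section

/-- The `i`-th partial derivative of `f : ℝⁿ → ℝ` at `x`. -/
def pd {n : ℕ} (f : (Fin n → ℝ) → ℝ) (i : Fin n) (x : Fin n → ℝ) : ℝ :=
  fderiv ℝ f x (Pi.single i 1)

/-- Components of the hyperbolic metric on ℝⁿ:
`ḡ_{ij}(x) = δ_{ij} − xᵢxⱼ/(1+‖x‖²)`. -/
def gbar {n : ℕ} (i j : Fin n) (x : Fin n → ℝ) : ℝ :=
  (if i = j then 1 else 0) - x i * x j / (1 + ∑ k, x k ^ 2)

/-- Components of the inverse hyperbolic metric: `ḡ^{ij}(x) = δ_{ij} + xᵢxⱼ`. -/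
def ginv {n : ℕ} (i j : Fin n) (x : Fin n → ℝ) : ℝ :=
  (if i = j then 1 else 0) + x i * x j

/-- Christoffel symbols `Γ̄^k_{ij}` of the hyperbolic metric. -/
def Gam {n : ℕ} (k i j : Fin n) (x : Fin n → ℝ) : ℝ :=
  (1 / 2) * ∑ l, ginv k l x *
    (pd (gbar j l) i x + pd (gbar i l) j x - pd (gbar i j) l x)

/-- The static potential `V(x) = A⁰√(1+‖x‖²) + ∑ᵢ Aⁱxⁱ`. -/
def Vpot {n : ℕ} (A0 : ℝ) (A : Fin n → ℝ) (x : Fin n → ℝ) : ℝ :=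
  A0 * Real.sqrt (1 + ∑ k, x k ^ 2) + ∑ i, A i * x i

theorem HasFDerivAt.pd_eq {n : ℕ} {f : (Fin n → ℝ) → ℝ} {f' : (Fin n → ℝ) →L[ℝ] ℝ}
    {x : Fin n → ℝ} (h : HasFDerivAt f f' x) (i : Fin n) : pd f i x = f' (Pi.single i 1) := by
  rw [pd, h.fderiv]

theorem one_add_sum_sq_pos {n : ℕ} (x : Fin n → ℝ) : 0 < 1 + ∑ k, x k ^ 2 := by
  positivity

theorem pd_gbar {n : ℕ} (j l i : Fin n) (x : Fin n → ℝ) :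
    pd (gbar j l) i x =
      -(((if j = i then 1 else 0) * x l + x j * (if l = i then 1 else 0)) / (1 + ∑ k, x k ^ 2))
        + 2 * x i * x j * x l / (1 + ∑ k, x k ^ 2) ^ 2 := by
  have hw := (one_add_sum_sq_pos x).ne'
  have hc (k : Fin n) : HasFDerivAt (fun y : Fin n → ℝ => y k)
      (ContinuousLinearMap.proj (R := ℝ) (φ := fun _ : Fin n => ℝ) k) x := hasFDerivAt_apply k x
  have hs := (HasFDerivAt.fun_sum (u := Finset.univ) fun k _ => (hc k).pow 2).const_add 1
  have hinv := (hasDerivAt_inv hw).comp_hasFDerivAt x hs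
  have h := ((((hc j).mul (hc l)).mul hinv).const_sub (if j = l then (1 : ℝ) else 0))
  have h' : pd (gbar j l) i x = _ := HasFDerivAt.pd_eq h i
  rw [h']
  simp [Pi.single_apply]
  split_ifs <;> field_simp <;> ring

theorem sum_ginv_mul {n : ℕ} (k : Fin n) (x v : Fin n → ℝ) :
    ∑ l, ginv k l x * v l = v k + x k * ∑ l, x l * v l := by
  simp [ginv, add_mul, Finset.sum_add_distrib, Finset.mul_sum, mul_assoc]

theorem sum_gbar_mul {n : ℕ} (k : Fin n) (x v : Fin n → ℝ) :
    ∑ l, gbar k l x * v l = v k - x k * (∑ l, x l * v l) / (1 + ∑ l, x l ^ 2) := by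
  simp only [gbar, sub_mul, Finset.sum_sub_distrib, ite_mul, one_mul, zero_mul,
    Finset.sum_ite_eq, Finset.mem_univ, if_true, Finset.mul_sum, Finset.sum_div]
  congr 1
  exact Finset.sum_congr rfl fun l _ => by ring

/-- The Christoffel symbols of the hyperbolic metric are `Γ̄^k_{ij} = -xₖ ḡ_{ij}`. -/
theorem Gam_eq {n : ℕ} (k i j : Fin n) (x : Fin n → ℝ) : Gam k i j x = -(x k * gbar i j x) := by
  have hw := (one_add_sum_sq_pos x).ne'
  have h (l : Fin n) : pd (gbar j l) i x + pd (gbar i l) j x - pd (gbar i j) l x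
      = -2 * gbar i j x / (1 + ∑ k, x k ^ 2) * x l := by
    simp only [pd_gbar, gbar, eq_comm (a := j) (b := i), eq_comm (a := l)]
    field_simp
    ring
  have hx : ∑ l, x l * x l = ∑ l, x l ^ 2 := by simp only [sq]
  rw [Gam]
  simp_rw [h]
  rw [sum_ginv_mul]
  simp_rw [mul_left_comm (x _)]
  rw [← Finset.mul_sum, hx]
  field_simp
  ring

theorem sum_ginv_mul_mul {n : ℕ} (x p : Fin n → ℝ) :
    ∑ i, ∑ j, ginv i j x * p i * p j = ∑ i, p i ^ 2 + (∑ i, x i * p i) ^ 2 := by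
  have h (i : Fin n) : ∑ j, ginv i j x * p i * p j
      = p i ^ 2 + (∑ j, x j * p j) * (x i * p i) := by
    simp_rw [mul_right_comm _ (p i)]
    rw [← Finset.sum_mul, sum_ginv_mul]
    ring
  simp_rw [h]
  rw [Finset.sum_add_distrib, ← Finset.mul_sum, sq (∑ i, x i * p i)]

theorem differentiable_pd {n : ℕ} {V : (Fin n → ℝ) → ℝ} (hV : ContDiff ℝ 2 V) (i : Fin n) :
    Differentiable ℝ (pd V i) :=
  ((hV.fderiv_right (m := 1) (by norm_num)).clm_apply contDiff_const).differentiable (by norm_num)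

/-- for any `C²` solution `V` of the static KID equation of hyperbolic
space, the function `|∇V|²_ḡ − V²` is constant on ℝⁿ. -/
theorem grad_sq_minus_V_sq_const (n : ℕ) (hn : 1 ≤ n) (V : (Fin n → ℝ) → ℝ)
    (hV : ContDiff ℝ 2 V)
    (hKID : ∀ (x : Fin n → ℝ) (i j : Fin n),
      pd (pd V j) i x - ∑ k, Gam k i j x * pd V k x = V x * gbar i j x) :
    ∃ c : ℝ, ∀ x : Fin n → ℝ,
      (∑ i, ∑ j, ginv i j x * pd V i x * pd V j x) - (V x) ^ 2 = c := by
  have hess (x : Fin n → ℝ) (i j : Fin n) :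
      pd (pd V j) i x = (V x - ∑ k, x k * pd V k x) * gbar i j x := by
    have h := hKID x i j
    have hG : ∑ k, Gam k i j x * pd V k x = -(gbar i j x * ∑ k, x k * pd V k x) := by
      rw [Finset.mul_sum, ← Finset.sum_neg_distrib]
      exact Finset.sum_congr rfl fun k _ => by rw [Gam_eq]; ring
    rw [hG] at h
    linear_combination h
  simp_rw [sum_ginv_mul_mul]
  set F : (Fin n → ℝ) → ℝ := fun x =>
    ∑ i, pd V i x ^ 2 + (∑ i, x i * pd V i x) ^ 2 - V x ^ 2
  have hp (x : Fin n → ℝ) (i : Fin n) := (differentiable_pd hV i x).hasFDerivAt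
  have hc (x : Fin n → ℝ) (k : Fin n) : HasFDerivAt (fun y : Fin n → ℝ => y k)
      (ContinuousLinearMap.proj (R := ℝ) (φ := fun _ : Fin n => ℝ) k) x := hasFDerivAt_apply k x
  have hd (x : Fin n → ℝ) :=
    ((HasFDerivAt.fun_sum (u := Finset.univ) fun i _ => (hp x i).pow 2).add
      ((HasFDerivAt.fun_sum (u := Finset.univ) fun i _ => (hc x i).mul (hp x i)).pow 2)).sub
      ((hV.differentiable (by norm_num) x).hasFDerivAt.pow 2)
  have hFd : Differentiable ℝ F := fun x => (hd x).differentiableAt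
  have hzero (x : Fin n → ℝ) (m : Fin n) : pd F m x = 0 := by
    have h : pd F m x = _ := HasFDerivAt.pd_eq (hd x) m
    have e (i j : Fin n) : fderiv ℝ (pd V j) x (Pi.single i 1) = _ := hess x i j
    have e' (i : Fin n) : fderiv ℝ V x (Pi.single i 1) = pd V i x := rfl
    have h1 := sum_gbar_mul m x fun l => pd V l x
    have h2 := sum_gbar_mul m x x
    have hx : ∑ l, x l * x l = ∑ l, x l ^ 2 := by simp only [sq]
    have hw := (one_add_sum_sq_pos x).ne'
    have r1 (c : ℝ) : ∑ l, 2 * pd V l x * (c * gbar m l x)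
        = 2 * c * ∑ l, gbar m l x * pd V l x := by
      rw [Finset.mul_sum]
      exact Finset.sum_congr rfl fun l _ => by ring
    have r2 (c : ℝ) : ∑ l, x l * (c * gbar m l x) = c * ∑ l, gbar m l x * x l := by
      rw [Finset.mul_sum]
      exact Finset.sum_congr rfl fun l _ => by ring
    rw [h]
    simp [e, e', Pi.single_apply, Finset.sum_add_distrib]
    rw [r1, r2, h1, h2, hx]
    field_simp
    ring
  refine ⟨F 0, fun x => is_const_of_fderiv_eq_zero hFd (fun y => ?_) x 0⟩
  refine ContinuousLinearMap.coe_injective ((Pi.basisFun ℝ (Fin n)).ext fun m => ?_)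
  simpa [pd] using hzero y m
end
end

section
/- Let n ≥ 2, let U ⊆ ℝⁿ be open, let g and ḡ be two smooth Riemannian metrics on U, and set h_{ij} := g_{ij} − ḡ_{ij}. Then at every point of U the scalar curvature of g satisfies the exact identity: R(g) = ∑_{i,j} Ric(ḡ)_{ij} g^{ij} + ∇̄ₖ[ ∑_{i,j,ℓ} g^{ij} g^{kℓ} ( ∇̄ᵢh_{jℓ} − ∇̄_ℓh_{ji} ) ] + Q, where Q := (1/4) ∑_{i,j,k,p,ℓ,q} g^{ij} g^{kp} g^{ℓq} ( 2 ∇̄ₚh_{jℓ} ∇̄_qh_{ki} − ∇̄_ℓh_{kp} ∇̄_qh_{ij} − ∇̄ᵢh_{pq} ∇̄ⱼh_{kℓ} ). Here ∇̄ₖh_{ij} := ∂ₖh_{ij} − ∑_ℓ ( Γ(ḡ)^ℓ_{ki}h_{ℓj} + Γ(ḡ)^ℓ_{kj}h_{iℓ} ) is the ḡ-covariant derivative of h, and for a vector field W^k the divergence is ∇̄ₖW^k := ∑ₖ ∂ₖW^k + ∑_{k,ℓ} Γ(ḡ)^k_{kℓ} W^ℓ. -/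
open Real

noncomputable section

/-- Christoffel symbols `Γ(g)^k_{ij}` of a metric with components `g` and inverse
components `gi`. -/
def Christ {n : ℕ} (g gi : Fin n → Fin n → (Fin n → ℝ) → ℝ) (k i j : Fin n)
    (x : Fin n → ℝ) : ℝ :=
  (1 / 2) * ∑ l, gi k l x * (pd (g j l) i x + pd (g i l) j x - pd (g i j) l x)

/-- The Ricci tensor `Ric(g)_{ij}` of a metric with components `g` and inverse
components `gi`. -/
def RicciOf {n : ℕ} (g gi : Fin n → Fin n → (Fin n → ℝ) → ℝ) (i j : Fin n)
    (x : Fin n → ℝ) : ℝ :=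
  (∑ k, (pd (Christ g gi k i j) k x - pd (Christ g gi k i k) j x)) +
    ∑ k, ∑ l, (Christ g gi k k l x * Christ g gi l i j x
      - Christ g gi k j l x * Christ g gi l i k x)

/-- `g` is a smooth Riemannian metric on the open set `U` with inverse `gi`. -/
def IsMetricOn {n : ℕ} (g gi : Fin n → Fin n → (Fin n → ℝ) → ℝ)
    (U : Set (Fin n → ℝ)) : Prop :=
  (∀ i j, ContDiffOn ℝ (⊤ : ℕ∞) (g i j) U) ∧
  (∀ i j, ∀ x ∈ U, g i j x = g j i x) ∧
  (∀ x ∈ U, ∀ i j, (∑ k, g i k x * gi k j x) = if i = j then (1 : ℝ) else 0) ∧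
  (∀ x ∈ U, ∀ v : Fin n → ℝ, v ≠ 0 → 0 < ∑ i, ∑ j, g i j x * v i * v j)

/-- The difference `h_{ij} := g_{ij} − ḡ_{ij}` of two metrics. -/
def hdiff {n : ℕ} (g bg : Fin n → Fin n → (Fin n → ℝ) → ℝ) (i j : Fin n)
    (y : Fin n → ℝ) : ℝ :=
  g i j y - bg i j y

/-- The `ḡ`-covariant derivative `∇̄ₖh_{ij}` of a symmetric 2-tensor field `h`,
where `ḡ` has components `bg` and inverse `bgi`. -/
def covD {n : ℕ} (bg bgi h : Fin n → Fin n → (Fin n → ℝ) → ℝ) (k i j : Fin n)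
    (x : Fin n → ℝ) : ℝ :=
  pd (h i j) k x
    - ∑ l, (Christ bg bgi l k i x * h l j x + Christ bg bgi l k j x * h i l x)

/-- The vector field `W^k = ∑_{i,j,ℓ} g^{ij} g^{kℓ} (∇̄ᵢh_{jℓ} − ∇̄_ℓh_{ji})` whose
`ḡ`-divergence isolates the mass contribution in the scalar curvature. -/
def Wvec {n : ℕ} (g gi bg bgi : Fin n → Fin n → (Fin n → ℝ) → ℝ) (k : Fin n)
    (y : Fin n → ℝ) : ℝ :=
  ∑ i, ∑ j, ∑ l, gi i j y * gi k l y *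
    (covD bg bgi (hdiff g bg) i j l y - covD bg bgi (hdiff g bg) l j i y)

section Calculus

variable {n : ℕ} {f f' : (Fin n → ℝ) → ℝ} {x : Fin n → ℝ}

lemma pd_congr (h : f =ᶠ[nhds x] f') (k : Fin n) : pd f k x = pd f' k x := by
  unfold pd; rw [h.fderiv_eq]

lemma pd_sub (hf : DifferentiableAt ℝ f x) (hf' : DifferentiableAt ℝ f' x) (k : Fin n) :
    pd (fun y => f y - f' y) k x = pd f k x - pd f' k x := by
  unfold pd; rw [fderiv_fun_sub hf hf']; rfl

lemma pd_mul (hf : DifferentiableAt ℝ f x) (hf' : DifferentiableAt ℝ f' x) (k : Fin n) :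
    pd (fun y => f y * f' y) k x = pd f k x * f' x + f x * pd f' k x := by
  unfold pd; rw [fderiv_fun_mul hf hf']
  simp; ring

lemma pd_sum {ι : Type*} {s : Finset ι} {F : ι → (Fin n → ℝ) → ℝ}
    (hF : ∀ i ∈ s, DifferentiableAt ℝ (F i) x) (k : Fin n) :
    pd (fun y => ∑ i ∈ s, F i y) k x = ∑ i ∈ s, pd (F i) k x := by
  unfold pd; rw [fderiv_fun_sum hF]; simp

lemma pd_const (c : ℝ) (k : Fin n) : pd (fun _ => c) k x = 0 := by
  simp [pd]

lemma differentiableAt_det {ι E : Type*} [Fintype ι] [DecidableEq ι] [NormedAddCommGroup E]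
    [NormedSpace ℝ E] {M : E → Matrix ι ι ℝ} {x : E}
    (hM : ∀ i j, DifferentiableAt ℝ (fun y => M y i j) x) :
    DifferentiableAt ℝ (fun y => (M y).det) x := by
  simp only [Matrix.det_apply]
  refine DifferentiableAt.fun_sum fun σ _ => DifferentiableAt.const_smul ?_ _
  fun_prop

lemma differentiableAt_inv_entry {ι E : Type*} [Fintype ι] [DecidableEq ι] [NormedAddCommGroup E]
    [NormedSpace ℝ E] {M : E → Matrix ι ι ℝ} {x : E}
    (hM : ∀ i j, DifferentiableAt ℝ (fun y => M y i j) x) (hx : (M x).det ≠ 0) (i j : ι) :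
    DifferentiableAt ℝ (fun y => (M y)⁻¹ i j) x := by
  simp only [Matrix.inv_def, Ring.inverse_eq_inv', Matrix.smul_apply, smul_eq_mul,
    Matrix.adjugate_apply]
  refine ((differentiableAt_det hM).inv hx).mul (differentiableAt_det fun a b => ?_)
  by_cases h : a = j
  · simp [Matrix.updateRow_apply, h]
  · simpa [Matrix.updateRow_apply, h] using hM a b

end Calculus

section Metric

variable {n : ℕ} {g gi : Fin n → Fin n → (Fin n → ℝ) → ℝ} {U : Set (Fin n → ℝ)}
  {x : Fin n → ℝ}

lemma IsMetricOn.symm (hg : IsMetricOn g gi U) (hx : x ∈ U) (i j : Fin n) :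
    g i j x = g j i x := hg.2.1 i j x hx

lemma IsMetricOn.mul_inv (hg : IsMetricOn g gi U) (hx : x ∈ U) :
    (Matrix.of fun i j => g i j x) * (Matrix.of fun i j => gi i j x) = 1 := by
  ext i j
  simp [Matrix.mul_apply, Matrix.one_apply, hg.2.2.1 x hx i j]

lemma IsMetricOn.inv_eq (hg : IsMetricOn g gi U) (hx : x ∈ U) :
    (Matrix.of fun i j => g i j x)⁻¹ = Matrix.of fun i j => gi i j x :=
  Matrix.inv_eq_right_inv (hg.mul_inv hx)

lemma IsMetricOn.inv_mul (hg : IsMetricOn g gi U) (hx : x ∈ U) :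
    (Matrix.of fun i j => gi i j x) * (Matrix.of fun i j => g i j x) = 1 :=
  mul_eq_one_comm.mp (hg.mul_inv hx)

lemma IsMetricOn.inv_mul_apply (hg : IsMetricOn g gi U) (hx : x ∈ U) (i j : Fin n) :
    ∑ k, gi i k x * g k j x = if i = j then 1 else 0 := by
  have := congrFun (congrFun (hg.inv_mul hx) i) j
  simpa [Matrix.mul_apply, Matrix.one_apply] using this

lemma IsMetricOn.inv_symm (hg : IsMetricOn g gi U) (hx : x ∈ U) (i j : Fin n) :
    gi i j x = gi j i x := by
  have hs : (Matrix.of fun i j => g i j x).transpose = Matrix.of fun i j => g i j x := by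
    ext a b
    exact hg.symm hx b a
  have h := Matrix.transpose_nonsing_inv (Matrix.of fun i j => g i j x)
  rw [hs, hg.inv_eq hx] at h
  exact congrFun (congrFun h j) i

lemma IsMetricOn.contDiffAt (hg : IsMetricOn g gi U) (hU : IsOpen U) (hx : x ∈ U) (i j : Fin n) :
    ContDiffAt ℝ (⊤ : ℕ∞) (g i j) x :=
  (hg.1 i j).contDiffAt (hU.mem_nhds hx)

lemma IsMetricOn.differentiableAt (hg : IsMetricOn g gi U) (hU : IsOpen U) (hx : x ∈ U)
    (i j : Fin n) : DifferentiableAt ℝ (g i j) x :=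
  (hg.contDiffAt hU hx i j).differentiableAt (by simp)

lemma IsMetricOn.differentiableAt_inv (hg : IsMetricOn g gi U) (hU : IsOpen U) (hx : x ∈ U)
    (i j : Fin n) : DifferentiableAt ℝ (gi i j) x := by
  have h := differentiableAt_inv_entry (M := fun y => Matrix.of fun i j => g i j y)
    (fun i j => hg.differentiableAt hU hx i j)
    (by
      have := congrArg Matrix.det (hg.mul_inv hx)
      rw [Matrix.det_mul, Matrix.det_one] at this
      exact left_ne_zero_of_mul_eq_one this) i j
  refine h.congr_of_eventuallyEq ?_
  filter_upwards [hU.mem_nhds hx] with y hy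
  rw [hg.inv_eq hy]; rfl

lemma IsMetricOn.differentiableAt_pd (hg : IsMetricOn g gi U) (hU : IsOpen U) (hx : x ∈ U)
    (i j k : Fin n) : DifferentiableAt ℝ (pd (g i j) k) x := by
  have h : ContDiffAt ℝ 1 (fderiv ℝ (g i j)) x :=
    (hg.contDiffAt hU hx i j).fderiv_right (WithTop.coe_le_coe.2 le_top)
  exact (h.differentiableAt (by simp)).clm_apply (differentiableAt_const _)

lemma IsMetricOn.differentiableAt_Christ (hg : IsMetricOn g gi U) (hU : IsOpen U) (hx : x ∈ U)
    (k i j : Fin n) : DifferentiableAt ℝ (Christ g gi k i j) x := by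
  unfold Christ
  refine DifferentiableAt.const_mul (DifferentiableAt.fun_sum fun l _ => ?_) _
  exact (hg.differentiableAt_inv hU hx k l).mul (((hg.differentiableAt_pd hU hx _ _ _).add
    (hg.differentiableAt_pd hU hx _ _ _)).sub (hg.differentiableAt_pd hU hx _ _ _))

lemma IsMetricOn.pd_symm (hg : IsMetricOn g gi U) (hU : IsOpen U) (hx : x ∈ U)
    (i j k : Fin n) : pd (g i j) k x = pd (g j i) k x := by
  refine pd_congr ?_ k
  filter_upwards [hU.mem_nhds hx] with y hy using hg.symm hy i j

lemma IsMetricOn.Christ_symm (hg : IsMetricOn g gi U) (hU : IsOpen U) (hx : x ∈ U)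
    (k i j : Fin n) : Christ g gi k i j x = Christ g gi k j i x := by
  unfold Christ
  congr 1
  refine Finset.sum_congr rfl fun l _ => ?_
  rw [hg.pd_symm hU hx i j, hg.pd_symm hU hx i l, hg.pd_symm hU hx j l,
    hg.pd_symm hU hx l i, hg.pd_symm hU hx l j]
  ring

/-- Lowering the upper index of a vector raised with the inverse metric. -/
lemma IsMetricOn.lower_raise (hg : IsMetricOn g gi U) (hx : x ∈ U) (T : Fin n → ℝ) (j : Fin n) :
    ∑ l, (∑ m, gi l m x * T m) * g l j x = T j := by
  calc ∑ l, (∑ m, gi l m x * T m) * g l j x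
      = ∑ m, (∑ l, gi m l x * g l j x) * T m := by
        simp only [Finset.sum_mul]
        rw [Finset.sum_comm]
        refine Finset.sum_congr rfl fun m _ => Finset.sum_congr rfl fun l _ => ?_
        rw [hg.inv_symm hx l m]; ring
    _ = T j := by simp [hg.inv_mul_apply hx]

/-- Raising the index of a vector lowered with the metric. -/
lemma IsMetricOn.raise_lower (hg : IsMetricOn g gi U) (hx : x ∈ U) (T : Fin n → ℝ) (k : Fin n) :
    ∑ l, gi k l x * ∑ m, T m * g m l x = T k := by
  calc ∑ l, gi k l x * ∑ m, T m * g m l x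
      = ∑ m, (∑ l, gi k l x * g l m x) * T m := by
        simp only [Finset.sum_mul, Finset.mul_sum]
        rw [Finset.sum_comm]
        refine Finset.sum_congr rfl fun m _ => Finset.sum_congr rfl fun l _ => ?_
        rw [hg.symm hx m l]; ring
    _ = T k := by simp [hg.inv_mul_apply hx]

lemma IsMetricOn.lower_Christ (hg : IsMetricOn g gi U) (hx : x ∈ U) (k i j : Fin n) :
    ∑ l, Christ g gi l k i x * g l j x
      = (1 / 2) * (pd (g i j) k x + pd (g k j) i x - pd (g k i) j x) := by
  rw [← hg.lower_raise hx (fun m => pd (g i m) k x + pd (g k m) i x - pd (g k i) m x) j,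
    Finset.mul_sum]
  exact Finset.sum_congr rfl fun l _ => by unfold Christ; ring

/-- The Levi-Civita connection is compatible with its metric. -/
lemma IsMetricOn.pd_eq (hg : IsMetricOn g gi U) (hU : IsOpen U) (hx : x ∈ U) (k i j : Fin n) :
    pd (g i j) k x
      = ∑ l, (Christ g gi l k i x * g l j x + Christ g gi l k j x * g i l x) := by
  simp only [hg.symm hx i, Finset.sum_add_distrib, hg.lower_Christ hx]
  rw [hg.pd_symm hU hx j i, hg.pd_symm hU hx k i, hg.pd_symm hU hx k j, hg.pd_symm hU hx i k]
  rw [hg.pd_symm hU hx j k]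
  ring

/-- The partial derivatives of the inverse metric in terms of the Christoffel symbols. -/
lemma IsMetricOn.pd_inv_eq (hg : IsMetricOn g gi U) (hU : IsOpen U) (hx : x ∈ U)
    (k i j : Fin n) :
    pd (gi i j) k x
      = -∑ l, (Christ g gi i k l x * gi l j x + Christ g gi j k l x * gi i l x) := by
  let G : Matrix (Fin n) (Fin n) ℝ := Matrix.of fun i j => g i j x
  let H : Matrix (Fin n) (Fin n) ℝ := Matrix.of fun i j => gi i j x
  let dG : Matrix (Fin n) (Fin n) ℝ := Matrix.of fun i j => pd (g i j) k x
  let dH : Matrix (Fin n) (Fin n) ℝ := Matrix.of fun i j => pd (gi i j) k x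
  let P : Matrix (Fin n) (Fin n) ℝ := Matrix.of fun a m => Christ g gi m k a x
  have hGH : G * H = 1 := hg.mul_inv hx
  have hHG : H * G = 1 := hg.inv_mul hx
  have hdG : dG = P * G + G * P.transpose := by
    ext a b
    simp only [dG, P, G, Matrix.add_apply, Matrix.mul_apply, Matrix.of_apply,
      Matrix.transpose_apply, ← Finset.sum_add_distrib]
    rw [hg.pd_eq hU hx]
    exact Finset.sum_congr rfl fun l _ => by ring
  have hd : dG * H + G * dH = 0 := by
    ext a b
    have h0 : pd (fun y => ∑ l, g a l y * gi l b y) k x = 0 := by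
      rw [← pd_const (x := x) (if a = b then (1 : ℝ) else 0) k]
      refine pd_congr ?_ k
      filter_upwards [hU.mem_nhds hx] with y hy using hg.2.2.1 y hy a b
    rw [pd_sum fun l _ => (hg.differentiableAt hU hx a l).fun_mul
      (hg.differentiableAt_inv hU hx l b)] at h0
    simp only [dG, dH, G, H, Matrix.add_apply, Matrix.mul_apply, Matrix.of_apply,
      Matrix.zero_apply, ← Finset.sum_add_distrib]
    rw [← h0]
    exact Finset.sum_congr rfl fun l _ =>
      (pd_mul (hg.differentiableAt hU hx a l) (hg.differentiableAt_inv hU hx l b) k).symm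
  have hdH : dH = -(P.transpose * H + H * P) := by
    have h1 : dH = -(H * (dG * H)) := by
      have h2 : H * (dG * H + G * dH) = 0 := by rw [hd, mul_zero]
      rw [mul_add, ← mul_assoc H G, hHG, one_mul] at h2
      exact eq_neg_of_add_eq_zero_right h2
    rw [h1, hdG, add_mul, mul_add, mul_assoc P, hGH, mul_one, mul_assoc G, ← mul_assoc H G, hHG,
      one_mul, add_comm]
  have h := congrFun (congrFun hdH i) j
  simp only [dH, P, H, Matrix.neg_apply, Matrix.add_apply, Matrix.mul_apply, Matrix.of_apply,
      Matrix.transpose_apply, ← Finset.sum_add_distrib] at h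
  rw [h]
  exact congrArg _ (Finset.sum_congr rfl fun l _ => by ring)

end Metric

section Contractions

variable {ι : Type*} [Fintype ι]

/-- The contraction `g^{ij} X^k_{jl} Y^l_{ik}`. -/
def contrCross (G : ι → ι → ℝ) (X Y : ι → ι → ι → ℝ) : ℝ :=
  ∑ i, ∑ j, ∑ k, ∑ l, G i j * X k j l * Y l i k

/-- The contraction `g^{ij} X^k_{kl} Y^l_{ij}`. -/
def contrTrace (G : ι → ι → ℝ) (X Y : ι → ι → ι → ℝ) : ℝ :=
  ∑ i, ∑ j, ∑ k, ∑ l, G i j * X k k l * Y l i j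

/-- The contraction `g^{ij} X^k_{kj} Y^l_{il}` of two traces. -/
def contrTraces (G : ι → ι → ℝ) (X Y : ι → ι → ι → ℝ) : ℝ :=
  ∑ i, ∑ j, ∑ k, ∑ l, G i j * X k k j * Y l i l

lemma sum_perm_three (e : ι × ι × ι ≃ ι × ι × ι) {F F' : ι → ι → ι → ℝ}
    (h : ∀ i j k, F i j k
      = F' (e (i, j, k)).1 (e (i, j, k)).2.1 (e (i, j, k)).2.2) :
    ∑ i, ∑ j, ∑ k, F i j k = ∑ i, ∑ j, ∑ k, F' i j k := by
  have key : ∀ H : ι → ι → ι → ℝ, ∑ i, ∑ j, ∑ k, H i j k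
      = ∑ p : ι × ι × ι, H p.1 p.2.1 p.2.2 := fun H => by
    simp only [Fintype.sum_prod_type]
  rw [key, key]
  exact Fintype.sum_equiv e _ _ fun _ => h _ _ _

lemma sum_perm_four (e : ι × ι × ι × ι ≃ ι × ι × ι × ι) {F F' : ι → ι → ι → ι → ℝ}
    (h : ∀ i j k l, F i j k l = F' (e (i, j, k, l)).1 (e (i, j, k, l)).2.1
      (e (i, j, k, l)).2.2.1 (e (i, j, k, l)).2.2.2) :
    ∑ i, ∑ j, ∑ k, ∑ l, F i j k l = ∑ i, ∑ j, ∑ k, ∑ l, F' i j k l := by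
  have key : ∀ H : ι → ι → ι → ι → ℝ, ∑ i, ∑ j, ∑ k, ∑ l, H i j k l
      = ∑ p : ι × ι × ι × ι, H p.1 p.2.1 p.2.2.1 p.2.2.2 := fun H => by
    simp only [Fintype.sum_prod_type]
  rw [key, key]
  exact Fintype.sum_equiv e _ _ fun _ => h _ _ _ _

lemma sum_perm_six (e : ι × ι × ι × ι × ι × ι ≃ ι × ι × ι × ι × ι × ι)
    {F F' : ι → ι → ι → ι → ι → ι → ℝ}
    (h : ∀ i j k p l q, F i j k p l q = F' (e (i, j, k, p, l, q)).1 (e (i, j, k, p, l, q)).2.1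
      (e (i, j, k, p, l, q)).2.2.1 (e (i, j, k, p, l, q)).2.2.2.1
      (e (i, j, k, p, l, q)).2.2.2.2.1 (e (i, j, k, p, l, q)).2.2.2.2.2) :
    ∑ i, ∑ j, ∑ k, ∑ p, ∑ l, ∑ q, F i j k p l q
      = ∑ i, ∑ j, ∑ k, ∑ p, ∑ l, ∑ q, F' i j k p l q := by
  have key : ∀ H : ι → ι → ι → ι → ι → ι → ℝ, ∑ i, ∑ j, ∑ k, ∑ p, ∑ l, ∑ q, H i j k p l q
      = ∑ p : ι × ι × ι × ι × ι × ι,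
        H p.1 p.2.1 p.2.2.1 p.2.2.2.1 p.2.2.2.2.1 p.2.2.2.2.2 := fun H => by
    simp only [Fintype.sum_prod_type]
  rw [key, key]
  exact Fintype.sum_equiv e _ _ fun _ => h _ _ _ _ _ _

variable {G : ι → ι → ℝ} {X Y Z : ι → ι → ι → ℝ}

lemma contrCross_comm (hG : ∀ i j, G i j = G j i) :
    contrCross G X Y = contrCross G Y X :=
  sum_perm_four
    ⟨fun (i, j, k, l) => (j, i, l, k), fun (j, i, l, k) => (i, j, k, l),
      fun _ => rfl, fun _ => rfl⟩ fun i j k l => by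
        simp only [Equiv.coe_fn_mk]
        rw [hG i j]; ring

lemma contrCross_sub_left :
    contrCross G (fun k i j => X k i j - Y k i j) Z = contrCross G X Z - contrCross G Y Z := by
  simp only [contrCross, mul_sub, sub_mul, Finset.sum_sub_distrib]

lemma contrCross_sub_right :
    contrCross G X (fun k i j => Y k i j - Z k i j) = contrCross G X Y - contrCross G X Z := by
  simp only [contrCross, mul_sub, Finset.sum_sub_distrib]

lemma contrTrace_sub_left :
    contrTrace G (fun k i j => X k i j - Y k i j) Z = contrTrace G X Z - contrTrace G Y Z := by
  simp only [contrTrace, mul_sub, sub_mul, Finset.sum_sub_distrib]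

lemma contrTrace_sub_right :
    contrTrace G X (fun k i j => Y k i j - Z k i j) = contrTrace G X Y - contrTrace G X Z := by
  simp only [contrTrace, mul_sub, Finset.sum_sub_distrib]

lemma contrTraces_sub_left :
    contrTraces G (fun k i j => X k i j - Y k i j) Z
      = contrTraces G X Z - contrTraces G Y Z := by
  simp only [contrTraces, mul_sub, sub_mul, Finset.sum_sub_distrib]

lemma sum_deriv_mul_eq_contrCross (hG : ∀ i j, G i j = G j i) (hX : ∀ k i j, X k i j = X k j i)
    (hY : ∀ k i j, Y k i j = Y k j i) :
    ∑ k, ∑ i, ∑ j, (-∑ l, (X i k l * G l j + X j k l * G i l)) * Y k i j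
      = -(2 * contrCross G X Y) := by
  have h1 : ∑ k, ∑ i, ∑ j, ∑ l, X i k l * G l j * Y k i j = contrCross G X Y :=
    sum_perm_four
      ⟨fun (k, i, j, l) => (j, l, i, k), fun (j, l, i, k) => (k, i, j, l),
        fun _ => rfl, fun _ => rfl⟩ fun k i j l => by
          simp only [Equiv.coe_fn_mk]
          rw [hG l j, hX i k l, hY k i j]; ring
  have h2 : ∑ k, ∑ i, ∑ j, ∑ l, X j k l * G i l * Y k i j = contrCross G X Y :=
    sum_perm_four
      ⟨fun (k, i, j, l) => (i, l, j, k), fun (i, l, j, k) => (k, i, j, l),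
        fun _ => rfl, fun _ => rfl⟩ fun k i j l => by
          simp only [Equiv.coe_fn_mk]
          rw [hX j k l]; ring
  simp only [neg_mul, Finset.sum_mul, add_mul, Finset.sum_add_distrib, Finset.sum_neg_distrib,
    h1, h2]
  ring

lemma sum_deriv_mul_trace (hG : ∀ i j, G i j = G j i) (hY : ∀ k i j, Y k i j = Y k j i) :
    ∑ k, ∑ i, ∑ j, (-∑ l, (X k k l * G l i + X i k l * G k l)) * Y j i j
      = -(contrTraces G X Y + contrTrace G Y X) := by
  have h1 : ∑ k, ∑ i, ∑ j, ∑ l, X k k l * G l i * Y j i j = contrTraces G X Y :=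
    sum_perm_four
      ⟨fun (k, i, j, l) => (i, l, k, j), fun (i, l, k, j) => (k, i, j, l),
        fun _ => rfl, fun _ => rfl⟩ fun k i j l => by
          simp only [Equiv.coe_fn_mk]
          rw [hG l i]; ring
  have h2 : ∑ k, ∑ i, ∑ j, ∑ l, X i k l * G k l * Y j i j = contrTrace G Y X :=
    sum_perm_four
      ⟨fun (k, i, j, l) => (k, l, j, i), fun (k, l, j, i) => (k, i, j, l),
        fun _ => rfl, fun _ => rfl⟩ fun k i j l => by
          simp only [Equiv.coe_fn_mk]
          rw [hY j i j]; ring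
  simp only [neg_mul, Finset.sum_mul, add_mul, Finset.sum_add_distrib, Finset.sum_neg_distrib,
    h1, h2]

lemma sum_trace_mul (hG : ∀ i j, G i j = G j i) :
    ∑ k, ∑ l, X k k l * ((∑ i, ∑ j, G i j * Y l i j) - ∑ i, ∑ j, G l i * Y j i j)
      = contrTrace G X Y - contrTraces G X Y := by
  have h1 : ∑ k, ∑ l, ∑ i, ∑ j, X k k l * (G i j * Y l i j) = contrTrace G X Y :=
    sum_perm_four
      ⟨fun (k, l, i, j) => (i, j, k, l), fun (i, j, k, l) => (k, l, i, j),
        fun _ => rfl, fun _ => rfl⟩ fun k l i j => by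
          simp only [Equiv.coe_fn_mk]
          ring
  have h2 : ∑ k, ∑ l, ∑ i, ∑ j, X k k l * (G l i * Y j i j) = contrTraces G X Y :=
    sum_perm_four
      ⟨fun (k, l, i, j) => (i, l, k, j), fun (i, l, k, j) => (k, l, i, j),
        fun _ => rfl, fun _ => rfl⟩ fun k l i j => by
          simp only [Equiv.coe_fn_mk]
          rw [hG l i]; ring
  simp only [mul_sub, Finset.mul_sum, Finset.sum_sub_distrib, h1, h2]

/-- Tracing the difference tensor of two connections. -/
lemma sum_traces_eq {a D : ι → ι → ι → ℝ} (hG : ∀ i j, G i j = G j i)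
    (hD : ∀ k i j, D k i j = (1 / 2) * ∑ l, G k l * (a i j l + a j i l - a l i j)) (i : ι) :
    ∑ j, D j i j = (1 / 2) * ∑ j, ∑ l, G j l * a i j l := by
  have h : ∑ j, ∑ l, G j l * a l i j = ∑ j, ∑ l, G j l * a j i l := by
    rw [Finset.sum_comm]
    exact Finset.sum_congr rfl fun j _ => Finset.sum_congr rfl fun l _ => by rw [hG]
  simp only [hD, mul_sub, mul_add, Finset.sum_sub_distrib, Finset.sum_add_distrib,
    ← Finset.mul_sum, h]
  ring

lemma sum_divergence_field_eq {a D : ι → ι → ι → ℝ} (hG : ∀ i j, G i j = G j i)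
    (ha : ∀ k i j, a k i j = a k j i)
    (hD : ∀ k i j, D k i j = (1 / 2) * ∑ l, G k l * (a i j l + a j i l - a l i j)) (k : ι) :
    ∑ i, ∑ j, ∑ l, G i j * G k l * (a i j l - a l j i)
      = (∑ i, ∑ j, G i j * D k i j) - ∑ i, ∑ j, G k i * D j i j := by
  have h1 : ∑ i, ∑ j, ∑ l, G i j * G k l * a j i l = ∑ i, ∑ j, ∑ l, G i j * G k l * a i j l := by
    rw [Finset.sum_comm]
    exact Finset.sum_congr rfl fun i _ => Finset.sum_congr rfl fun j _ => by rw [hG]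
  have h2 : ∑ i, ∑ j, G k i * D j i j = (1 / 2) * ∑ i, ∑ j, ∑ l, G i j * G k l * a l i j := by
    simp only [← Finset.mul_sum, sum_traces_eq hG hD]
    simp only [Finset.mul_sum]
    refine sum_perm_three
      ⟨fun (i, j, l) => (j, l, i), fun (j, l, i) => (i, j, l),
        fun _ => rfl, fun _ => rfl⟩ fun i j l => ?_
    simp only [Equiv.coe_fn_mk]
    ring
  have h3 : ∑ i, ∑ j, G i j * D k i j
      = (1 / 2) * ((∑ i, ∑ j, ∑ l, G i j * G k l * a i j l)
        + (∑ i, ∑ j, ∑ l, G i j * G k l * a j i l)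
        - ∑ i, ∑ j, ∑ l, G i j * G k l * a l i j) := by
    simp only [hD, Finset.mul_sum, ← Finset.sum_add_distrib, ← Finset.sum_sub_distrib]
    refine Finset.sum_congr rfl fun i _ => Finset.sum_congr rfl fun j _ =>
      Finset.sum_congr rfl fun l _ => ?_
    ring
  have h4 : ∑ i, ∑ j, ∑ l, G i j * G k l * (a i j l - a l j i)
      = (∑ i, ∑ j, ∑ l, G i j * G k l * a i j l)
        - ∑ i, ∑ j, ∑ l, G i j * G k l * a l i j := by
    simp only [← Finset.sum_sub_distrib]
    refine Finset.sum_congr rfl fun i _ => Finset.sum_congr rfl fun j _ =>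
      Finset.sum_congr rfl fun l _ => ?_
    rw [ha l j i]; ring
  rw [h4, h3, h2, h1]
  ring

lemma contrTraces_self {a D : ι → ι → ι → ℝ} (hG : ∀ i j, G i j = G j i)
    (hDs : ∀ k i j, D k i j = D k j i)
    (hD : ∀ k i j, D k i j = (1 / 2) * ∑ l, G k l * (a i j l + a j i l - a l i j)) :
    contrTraces G D D = (1 / 4) * ∑ i, ∑ j, ∑ k, ∑ p, ∑ l, ∑ q,
      G i j * G k p * G l q * (a l k p * a q i j) := by
  have h : contrTraces G D D
      = ∑ i, ∑ j, (G i j * ∑ k, D k j k) * ∑ l, D l i l := by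
    unfold contrTraces
    refine Finset.sum_congr rfl fun i _ => Finset.sum_congr rfl fun j _ => ?_
    simp only [Finset.mul_sum, Finset.sum_mul]
    rw [Finset.sum_comm]
    exact Finset.sum_congr rfl fun l _ => Finset.sum_congr rfl fun k _ => by rw [hDs k k j]
  rw [h]
  simp only [sum_traces_eq hG hD, Finset.mul_sum, Finset.sum_mul]
  refine sum_perm_six
    ⟨fun (j', i', l, q, k, p) => (l, q, k, p, i', j'),
      fun (l, q, k, p, i', j') => (j', i', l, q, k, p),
      fun _ => rfl, fun _ => rfl⟩ fun i j k p l q => ?_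
  simp only [Equiv.coe_fn_mk]
  rw [hG i j]
  ring

lemma contrCross_self {a D : ι → ι → ι → ℝ} (hG : ∀ i j, G i j = G j i)
    (ha : ∀ k i j, a k i j = a k j i)
    (hD : ∀ k i j, D k i j = (1 / 2) * ∑ l, G k l * (a i j l + a j i l - a l i j)) :
    contrCross G D D = (1 / 4) * ∑ i, ∑ j, ∑ k, ∑ p, ∑ l, ∑ q,
      G i j * G k p * G l q * (2 * a p j l * a q k i - a i p q * a j k l) := by
  let L : (ι → ι → ι → ι → ι → ι → ℝ) → ℝ := fun F =>
    ∑ i, ∑ j, ∑ k, ∑ p, ∑ l, ∑ q, G i j * G k p * G l q * F i j k p l q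
  have hL : ∀ F, L F = ∑ i, ∑ j, ∑ k, ∑ p, ∑ l, ∑ q, G i j * G k p * G l q * F i j k p l q :=
    fun _ => rfl
  have hflip : ∀ F, L F = L fun i j k p l q => F i j q l p k := fun F =>
    sum_perm_six
      ⟨fun (i, j, k, p, l, q) => (i, j, q, l, p, k), fun (i, j, k, p, l, q) => (i, j, q, l, p, k),
        fun _ => rfl, fun _ => rfl⟩ fun i j k p l q => by
          simp only [Equiv.coe_fn_mk]
          rw [hG q l, hG p k]; ring
  have h0 : contrCross G D D = (1 / 4) * L fun i j k p l q =>
      (a j l p + a l j p - a p j l) * (a i k q + a k i q - a q i k) := by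
    simp only [contrCross, hD, hL, Finset.mul_sum, Finset.sum_mul]
    refine sum_perm_six
      ⟨fun (i, j, k, l, q, p) => (i, j, k, p, l, q),
        fun (i, j, k, p, l, q) => (i, j, k, l, q, p),
        fun _ => rfl, fun _ => rfl⟩ fun i j k l q p => ?_
    simp only [Equiv.coe_fn_mk]
    ring
  have h1 : (L fun i j k p l q =>
      (a j l p + a l j p - a p j l) * (a i k q + a k i q - a q i k))
      = (L fun i j k p l q => a j l p * a i k q)
        + ((L fun i j k p l q => a j l p * a k i q) - L fun i j k p l q => a j l p * a q i k)
        + ((L fun i j k p l q => a l j p * a i k q) - L fun i j k p l q => a p j l * a i k q)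
        + ((L fun i j k p l q => a l j p * a k i q) + L fun i j k p l q => a p j l * a q i k)
        - ((L fun i j k p l q => a l j p * a q i k) + L fun i j k p l q => a p j l * a k i q) := by
    simp only [hL, ← Finset.sum_add_distrib, ← Finset.sum_sub_distrib]
    refine Finset.sum_congr rfl fun i _ => Finset.sum_congr rfl fun j _ =>
      Finset.sum_congr rfl fun k _ => Finset.sum_congr rfl fun p _ =>
      Finset.sum_congr rfl fun l _ => Finset.sum_congr rfl fun q _ => ?_
    ring
  have h2 : (L fun i j k p l q => a j l p * a k i q) = L fun i j k p l q => a j l p * a q i k := by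
    rw [hflip]
    exact congrArg L (by funext i j k p l q; rw [ha j p l])
  have h3 : (L fun i j k p l q => a l j p * a i k q) = L fun i j k p l q => a p j l * a i k q := by
    rw [hflip]
    exact congrArg L (by funext i j k p l q; rw [ha i q k])
  have h4 : (L fun i j k p l q => a l j p * a k i q) = L fun i j k p l q => a p j l * a q i k := by
    rw [hflip]
  have h5 : (L fun i j k p l q => a l j p * a q i k) = L fun i j k p l q => a p j l * a k i q := by
    rw [hflip]
  have h6 : (L fun i j k p l q => a p j l * a k i q) = L fun i j k p l q => a j l p * a i k q :=
    sum_perm_six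
      ⟨fun (i, j, k, p, l, q) => (k, p, q, l, j, i), fun (k, p, q, l, j, i) => (i, j, k, p, l, q),
        fun _ => rfl, fun _ => rfl⟩ fun i j k p l q => by
          simp only [Equiv.coe_fn_mk]
          rw [hG q l, hG j i, ha k i q]; ring
  have h7 : (L fun i j k p l q => a i p q * a j k l) = L fun i j k p l q => a j l p * a i k q :=
    sum_perm_six
      ⟨fun (i, j, k, p, l, q) => (i, j, p, k, l, q), fun (i, j, p, k, l, q) => (i, j, k, p, l, q),
        fun _ => rfl, fun _ => rfl⟩ fun i j k p l q => by
          simp only [Equiv.coe_fn_mk]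
          rw [hG p k, ha j k l]; ring
  have h8 : (L fun i j k p l q => 2 * a p j l * a q k i - a i p q * a j k l)
      = 2 * (L fun i j k p l q => a p j l * a q i k) - L fun i j k p l q => a i p q * a j k l := by
    simp only [hL, Finset.mul_sum, ← Finset.sum_sub_distrib]
    refine Finset.sum_congr rfl fun i _ => Finset.sum_congr rfl fun j _ =>
      Finset.sum_congr rfl fun k _ => Finset.sum_congr rfl fun p _ =>
      Finset.sum_congr rfl fun l _ => Finset.sum_congr rfl fun q _ => ?_
    rw [ha q k i]; ring
  rw [← hL, h0, h1, h2, h3, h4, h5, h6, h8, h7]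
  ring

lemma contrCross_self_sub_contrTraces_self {a D : ι → ι → ι → ℝ} (hG : ∀ i j, G i j = G j i)
    (ha : ∀ k i j, a k i j = a k j i) (hDs : ∀ k i j, D k i j = D k j i)
    (hD : ∀ k i j, D k i j = (1 / 2) * ∑ l, G k l * (a i j l + a j i l - a l i j)) :
    contrCross G D D - contrTraces G D D = (1 / 4) * ∑ i, ∑ j, ∑ k, ∑ p, ∑ l, ∑ q,
      G i j * G k p * G l q
        * (2 * a p j l * a q k i - a l k p * a q i j - a i p q * a j k l) := by
  rw [contrCross_self hG ha hD, contrTraces_self hG hDs hD, ← mul_sub]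
  simp only [← Finset.sum_sub_distrib]
  refine congrArg _ (Finset.sum_congr rfl fun i _ => Finset.sum_congr rfl fun j _ =>
    Finset.sum_congr rfl fun k _ => Finset.sum_congr rfl fun p _ =>
    Finset.sum_congr rfl fun l _ => Finset.sum_congr rfl fun q _ => ?_)
  ring

end Contractions

section Difference

variable {n : ℕ} {g gi bg bgi : Fin n → Fin n → (Fin n → ℝ) → ℝ} {U : Set (Fin n → ℝ)}
  {x : Fin n → ℝ}

/-- The difference `Γ(g)^k_{ij} - Γ(ḡ)^k_{ij}` of the Christoffel symbols of two metrics. -/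
def christDiff (g gi bg bgi : Fin n → Fin n → (Fin n → ℝ) → ℝ) (k i j : Fin n)
    (y : Fin n → ℝ) : ℝ :=
  Christ g gi k i j y - Christ bg bgi k i j y

lemma christDiff_symm (hU : IsOpen U) (hg : IsMetricOn g gi U) (hbg : IsMetricOn bg bgi U)
    (hx : x ∈ U) (k i j : Fin n) :
    christDiff g gi bg bgi k i j x = christDiff g gi bg bgi k j i x := by
  unfold christDiff
  rw [hg.Christ_symm hU hx, hbg.Christ_symm hU hx]

lemma differentiableAt_christDiff (hU : IsOpen U) (hg : IsMetricOn g gi U)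
    (hbg : IsMetricOn bg bgi U) (hx : x ∈ U) (k i j : Fin n) :
    DifferentiableAt ℝ (christDiff g gi bg bgi k i j) x :=
  (hg.differentiableAt_Christ hU hx k i j).fun_sub (hbg.differentiableAt_Christ hU hx k i j)

lemma covD_hdiff_eq (hU : IsOpen U) (hg : IsMetricOn g gi U) (hbg : IsMetricOn bg bgi U)
    (hx : x ∈ U) (k i j : Fin n) :
    covD bg bgi (hdiff g bg) k i j x
      = (∑ l, christDiff g gi bg bgi l k i x * g l j x)
        + ∑ l, christDiff g gi bg bgi l k j x * g l i x := by
  have h : pd (hdiff g bg i j) k x = pd (g i j) k x - pd (bg i j) k x :=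
    pd_sub (hg.differentiableAt hU hx i j) (hbg.differentiableAt hU hx i j) k
  rw [covD, h, hg.pd_eq hU hx, hbg.pd_eq hU hx]
  simp only [← Finset.sum_add_distrib, ← Finset.sum_sub_distrib]
  refine Finset.sum_congr rfl fun l _ => ?_
  rw [hg.symm hx l i]
  simp only [hdiff, christDiff]
  ring

lemma covD_hdiff_symm (hU : IsOpen U) (hg : IsMetricOn g gi U) (hbg : IsMetricOn bg bgi U)
    (hx : x ∈ U) (k i j : Fin n) :
    covD bg bgi (hdiff g bg) k i j x = covD bg bgi (hdiff g bg) k j i x := by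
  rw [covD_hdiff_eq hU hg hbg hx, covD_hdiff_eq hU hg hbg hx, add_comm]

/-- The Koszul formula for the difference tensor of two Levi-Civita connections. -/
lemma christDiff_eq (hU : IsOpen U) (hg : IsMetricOn g gi U) (hbg : IsMetricOn bg bgi U)
    (hx : x ∈ U) (k i j : Fin n) :
    christDiff g gi bg bgi k i j x
      = (1 / 2) * ∑ l, gi k l x * (covD bg bgi (hdiff g bg) i j l x
        + covD bg bgi (hdiff g bg) j i l x - covD bg bgi (hdiff g bg) l i j x) := by
  rw [← hg.raise_lower hx (fun m => christDiff g gi bg bgi m i j x) k, Finset.mul_sum]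
  refine Finset.sum_congr rfl fun l _ => ?_
  have hs := christDiff_symm hU hg hbg hx
  simp only [covD_hdiff_eq hU hg hbg hx]
  simp only [hs _ j i, hs _ l i, hs _ l j]
  ring

lemma Wvec_eq (hU : IsOpen U) (hg : IsMetricOn g gi U) (hbg : IsMetricOn bg bgi U)
    (hx : x ∈ U) (k : Fin n) :
    Wvec g gi bg bgi k x = (∑ i, ∑ j, gi i j x * christDiff g gi bg bgi k i j x)
      - ∑ i, ∑ j, gi k i x * christDiff g gi bg bgi j i j x :=
  sum_divergence_field_eq (hg.inv_symm hx) (covD_hdiff_symm hU hg hbg hx)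
    (christDiff_eq hU hg hbg hx) k

lemma pd_Wvec (hU : IsOpen U) (hg : IsMetricOn g gi U) (hbg : IsMetricOn bg bgi U)
    (hx : x ∈ U) (k m : Fin n) :
    pd (Wvec g gi bg bgi k) m x
      = (∑ i, ∑ j, (pd (gi i j) m x * christDiff g gi bg bgi k i j x
          + gi i j x * pd (christDiff g gi bg bgi k i j) m x))
        - ∑ i, ∑ j, (pd (gi k i) m x * christDiff g gi bg bgi j i j x
          + gi k i x * pd (christDiff g gi bg bgi j i j) m x) := by
  have hW : Wvec g gi bg bgi k =ᶠ[nhds x] fun y =>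
      (∑ i, ∑ j, gi i j y * christDiff g gi bg bgi k i j y)
        - ∑ i, ∑ j, gi k i y * christDiff g gi bg bgi j i j y := by
    filter_upwards [hU.mem_nhds hx] with y hy using Wvec_eq hU hg hbg hy k
  have hi := hg.differentiableAt_inv hU hx
  have hD := differentiableAt_christDiff hU hg hbg hx
  have h1 : ∀ i j, DifferentiableAt ℝ
      (fun y => gi i j y * christDiff g gi bg bgi k i j y) x :=
    fun i j => (hi i j).fun_mul (hD k i j)
  have h2 : ∀ i j, DifferentiableAt ℝ
      (fun y => gi k i y * christDiff g gi bg bgi j i j y) x :=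
    fun i j => (hi k i).fun_mul (hD j i j)
  rw [pd_congr hW,
    pd_sub (DifferentiableAt.fun_sum fun i _ => DifferentiableAt.fun_sum fun j _ => h1 i j)
      (DifferentiableAt.fun_sum fun i _ => DifferentiableAt.fun_sum fun j _ => h2 i j),
    pd_sum fun i _ => DifferentiableAt.fun_sum fun j _ => h1 i j,
    pd_sum fun i _ => DifferentiableAt.fun_sum fun j _ => h2 i j]
  congr 1
  · refine Finset.sum_congr rfl fun i _ => ?_
    rw [pd_sum fun j _ => h1 i j]
    exact Finset.sum_congr rfl fun j _ => pd_mul (hi i j) (hD k i j) m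
  · refine Finset.sum_congr rfl fun i _ => ?_
    rw [pd_sum fun j _ => h2 i j]
    exact Finset.sum_congr rfl fun j _ => pd_mul (hi k i) (hD j i j) m

lemma sum_pd_Wvec (hU : IsOpen U) (hg : IsMetricOn g gi U) (hbg : IsMetricOn bg bgi U)
    (hx : x ∈ U) :
    ∑ k, pd (Wvec g gi bg bgi k) k x
      = (∑ i, ∑ j, ∑ k, gi i j x * (pd (christDiff g gi bg bgi k i j) k x
          - pd (christDiff g gi bg bgi k i k) j x))
        - 2 * contrCross (fun i j => gi i j x) (fun k i j => Christ g gi k i j x)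
          (fun k i j => christDiff g gi bg bgi k i j x)
        + contrTraces (fun i j => gi i j x) (fun k i j => Christ g gi k i j x)
          (fun k i j => christDiff g gi bg bgi k i j x)
        + contrTrace (fun i j => gi i j x) (fun k i j => christDiff g gi bg bgi k i j x)
          (fun k i j => Christ g gi k i j x) := by
  have hi := hg.inv_symm hx
  have hΓ := hg.Christ_symm hU hx
  have hD := christDiff_symm hU hg hbg hx
  have h1 := sum_deriv_mul_eq_contrCross (G := fun i j => gi i j x)
    (X := fun k i j => Christ g gi k i j x) (Y := fun k i j => christDiff g gi bg bgi k i j x)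
    hi hΓ hD
  have h2 := sum_deriv_mul_trace (G := fun i j => gi i j x)
    (X := fun k i j => Christ g gi k i j x) (Y := fun k i j => christDiff g gi bg bgi k i j x)
    hi hD
  have h3 : ∑ k, ∑ i, ∑ j, gi i j x * pd (christDiff g gi bg bgi k i j) k x
      = ∑ i, ∑ j, ∑ k, gi i j x * pd (christDiff g gi bg bgi k i j) k x :=
    sum_perm_three
      ⟨fun (k, i, j) => (i, j, k), fun (i, j, k) => (k, i, j), fun _ => rfl, fun _ => rfl⟩
      fun _ _ _ => rfl
  have h4 : ∑ k, ∑ i, ∑ j, gi k i x * pd (christDiff g gi bg bgi j i j) k x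
      = ∑ i, ∑ j, ∑ k, gi i j x * pd (christDiff g gi bg bgi k i k) j x :=
    sum_perm_three
      ⟨fun (k, i, j) => (i, k, j), fun (i, k, j) => (k, i, j), fun _ => rfl, fun _ => rfl⟩
      fun k i j => by
        simp only [Equiv.coe_fn_mk]
        rw [hi]
  simp only [pd_Wvec hU hg hbg hx, hg.pd_inv_eq hU hx, mul_sub, Finset.sum_sub_distrib,
    Finset.sum_add_distrib] at h1 h2 ⊢
  rw [h1, h2, h3, h4]
  ring

lemma sum_inv_mul_RicciOf :
    ∑ i, ∑ j, gi i j x * RicciOf bg bgi i j x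
      = (∑ i, ∑ j, ∑ k, gi i j x * (pd (Christ bg bgi k i j) k x - pd (Christ bg bgi k i k) j x))
        + contrTrace (fun i j => gi i j x) (fun k i j => Christ bg bgi k i j x)
          (fun k i j => Christ bg bgi k i j x)
        - contrCross (fun i j => gi i j x) (fun k i j => Christ bg bgi k i j x)
          (fun k i j => Christ bg bgi k i j x) := by
  simp only [RicciOf, contrTrace, contrCross, Finset.mul_sum, mul_add, mul_sub,
    ← Finset.sum_add_distrib, ← Finset.sum_sub_distrib]
  simp only [Finset.sum_add_distrib, Finset.sum_sub_distrib, ← mul_assoc]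
  ring

/-- The term quadratic in `∇̄h` in terms of the difference tensor. -/
lemma quadratic_term_eq (hU : IsOpen U) (hg : IsMetricOn g gi U)
    (hbg : IsMetricOn bg bgi U) (hx : x ∈ U) :
    (1 / 4) * ∑ i, ∑ j, ∑ k, ∑ p, ∑ l, ∑ q,
            gi i j x * gi k p x * gi l q x *
              (2 * covD bg bgi (hdiff g bg) p j l x * covD bg bgi (hdiff g bg) q k i x
                - covD bg bgi (hdiff g bg) l k p x * covD bg bgi (hdiff g bg) q i j x
                - covD bg bgi (hdiff g bg) i p q x * covD bg bgi (hdiff g bg) j k l x)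
      = contrCross (fun i j => gi i j x) (fun k i j => christDiff g gi bg bgi k i j x)
          (fun k i j => christDiff g gi bg bgi k i j x)
        - contrTraces (fun i j => gi i j x) (fun k i j => christDiff g gi bg bgi k i j x)
          (fun k i j => christDiff g gi bg bgi k i j x) :=
  (contrCross_self_sub_contrTraces_self (a := fun k i j => covD bg bgi (hdiff g bg) k i j x)
    (hg.inv_symm hx) (covD_hdiff_symm hU hg hbg hx) (christDiff_symm hU hg hbg hx)
    (christDiff_eq hU hg hbg hx)).symm

lemma sum_Christ_mul_Wvec (hU : IsOpen U) (hg : IsMetricOn g gi U)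
    (hbg : IsMetricOn bg bgi U) (hx : x ∈ U) :
    ∑ k, ∑ l, Christ bg bgi k k l x * Wvec g gi bg bgi l x
      = contrTrace (fun i j => gi i j x) (fun k i j => Christ bg bgi k i j x)
          (fun k i j => christDiff g gi bg bgi k i j x)
        - contrTraces (fun i j => gi i j x) (fun k i j => Christ bg bgi k i j x)
          (fun k i j => christDiff g gi bg bgi k i j x) := by
  simp only [Wvec_eq hU hg hbg hx]
  exact sum_trace_mul (X := fun k i j => Christ bg bgi k i j x)
      (Y := fun k i j => christDiff g gi bg bgi k i j x) (hg.inv_symm hx)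

lemma sum_pd_christDiff (hU : IsOpen U) (hg : IsMetricOn g gi U)
    (hbg : IsMetricOn bg bgi U) (hx : x ∈ U) :
    ∑ i, ∑ j, ∑ k, gi i j x * (pd (christDiff g gi bg bgi k i j) k x
          - pd (christDiff g gi bg bgi k i k) j x)
      = (∑ i, ∑ j, ∑ k, gi i j x * (pd (Christ g gi k i j) k x - pd (Christ g gi k i k) j x))
        - ∑ i, ∑ j, ∑ k, gi i j x
          * (pd (Christ bg bgi k i j) k x - pd (Christ bg bgi k i k) j x) := by
  have hpd : ∀ k i j m, pd (christDiff g gi bg bgi k i j) m x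
      = pd (Christ g gi k i j) m x - pd (Christ bg bgi k i j) m x := fun k i j m =>
    pd_sub (hg.differentiableAt_Christ hU hx k i j) (hbg.differentiableAt_Christ hU hx k i j) m
  simp only [hpd, ← Finset.sum_sub_distrib]
  refine Finset.sum_congr rfl fun i _ => Finset.sum_congr rfl fun j _ =>
      Finset.sum_congr rfl fun k _ => ?_
  ring

end Difference

/-- the exact identity
`R(g) = ∑ Ric(ḡ)_{ij} g^{ij} + ∇̄ₖ W^k + Q` for the scalar curvature of `g` relative
to a background metric `ḡ`, with `Q` quadratic in `∇̄h`. -/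
theorem scalar_curvature_identity (n : ℕ) (hn : 2 ≤ n) (U : Set (Fin n → ℝ))
    (hU : IsOpen U) (g gi bg bgi : Fin n → Fin n → (Fin n → ℝ) → ℝ)
    (hg : IsMetricOn g gi U) (hbg : IsMetricOn bg bgi U)
    (x : Fin n → ℝ) (hx : x ∈ U) :
    (∑ i, ∑ j, gi i j x * RicciOf g gi i j x)
      = (∑ i, ∑ j, RicciOf bg bgi i j x * gi i j x)
        + ((∑ k, pd (Wvec g gi bg bgi k) k x)
            + ∑ k, ∑ l, Christ bg bgi k k l x * Wvec g gi bg bgi l x)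
        + (1 / 4) * ∑ i, ∑ j, ∑ k, ∑ p, ∑ l, ∑ q,
            gi i j x * gi k p x * gi l q x *
              (2 * covD bg bgi (hdiff g bg) p j l x * covD bg bgi (hdiff g bg) q k i x
                - covD bg bgi (hdiff g bg) l k p x * covD bg bgi (hdiff g bg) q i j x
                - covD bg bgi (hdiff g bg) i p q x * covD bg bgi (hdiff g bg) j k l x) := by
  have hbar : ∑ i, ∑ j, RicciOf bg bgi i j x * gi i j x
      = ∑ i, ∑ j, gi i j x * RicciOf bg bgi i j x := by
    simp only [mul_comm]
  have hcomm := contrCross_comm (X := fun k i j => Christ g gi k i j x)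
    (Y := fun k i j => Christ bg bgi k i j x) (hg.inv_symm hx)
  rw [quadratic_term_eq hU hg hbg hx, sum_Christ_mul_Wvec hU hg hbg hx, hbar,
    sum_pd_Wvec hU hg hbg hx, sum_pd_christDiff hU hg hbg hx, sum_inv_mul_RicciOf,
    sum_inv_mul_RicciOf]
  simp only [christDiff, contrCross_sub_left, contrCross_sub_right, contrTrace_sub_left,
    contrTrace_sub_right, contrTraces_sub_left] at hcomm ⊢
  linarith
end
end
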